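/- arXiv:1503.04991 — 3 statements merged into one kernel-verified Lean document; each statement's English description precedes it below -/
import Mathlib

section
/- Let P be a Dyck path of semilength n. Then the double pseudocomplement ∼∼P is the unique Dyck path Q of semilength n such that every factor of Q is a pyramid and Q has exactly the same returns as P; equivalently, ∼∼P is obtained from P by replacing each factor of P by the unique pyramid with the same number of steps (which is the unique pyramid greater than or equal to that factor of the same length). -/
/-- A Dyck path of semilength `n`, encoded by its height function:
`h t` is the height after the first `t` steps (number of `u`'s minus number of `d`'s
among the first `t` letters). -/
structure DyckPath (n : ℕ) where
  h : ℕ → ℤ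
  init : h 0 = 0
  tail : ∀ t, 2 * n ≤ t → h t = 0
  step : ∀ t, t < 2 * n → h (t + 1) = h t + 1 ∨ h (t + 1) = h t - 1
  nonneg : ∀ t, 0 ≤ h t

/-- The partial order on Dyck paths: `P ≤ Q` iff the height of `P` is pointwise
at most the height of `Q`. -/
def dle {n : ℕ} (P Q : DyckPath n) : Prop := ∀ t, P.h t ≤ Q.h t

/-- `R` is the relative pseudocomplement `P ⇝ Q` in the Dyck algebra `𝔇_n`:
`R` is the greatest Dyck path such that `P ∧ R ≤ Q` (meet being the pointwise
minimum of height functions). -/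
def IsRelPseudo {n : ℕ} (P Q R : DyckPath n) : Prop :=
  (∀ t, min (P.h t) (R.h t) ≤ Q.h t) ∧
  ∀ S : DyckPath n, (∀ t, min (P.h t) (S.h t) ≤ Q.h t) → dle S R

/-- The height function of the minimum Dyck path `(ud)^n`. -/
def minH (n : ℕ) (t : ℕ) : ℤ := if 2 * n ≤ t then 0 else (t : ℤ) % 2

/-- The minimum Dyck path `(ud)^n` of semilength `n`. -/
def minPath (n : ℕ) : DyckPath n where
  h := minH n
  init := by unfold minH; split_ifs <;> omega
  tail := by intro t ht; unfold minH; split_ifs <;> omega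
  step := by intro t ht; unfold minH; split_ifs <;> omega
  nonneg := by intro t; unfold minH; split_ifs <;> omega

/-- `R` is the pseudocomplement `∼P = P ⇝ 0` in the Dyck algebra `𝔇_n`. -/
def IsPseudo {n : ℕ} (P R : DyckPath n) : Prop := IsRelPseudo P (minPath n) R

/-- `x` is a return of `P`: an even abscissa `2 ≤ x ≤ 2n` where the path touches the `x`-axis. -/
def IsReturn {n : ℕ} (P : DyckPath n) (x : ℕ) : Prop :=
  Even x ∧ 2 ≤ x ∧ x ≤ 2 * n ∧ P.h x = 0

/-- Every factor of `P` (portion between two consecutive points of the path on the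
`x`-axis) is a pyramid `u^k d^k`, i.e. between two consecutive zeroes `a < b` of the
height function the height is `min (t - a) (b - t)`. -/
def FactorsArePyramids {n : ℕ} (P : DyckPath n) : Prop :=
  ∀ a b : ℕ, a < b → b ≤ 2 * n → P.h a = 0 → P.h b = 0 →
    (∀ c, a < c → c < b → 0 < P.h c) →
    ∀ t, a ≤ t → t ≤ b → P.h t = min ((t : ℤ) - (a : ℤ)) ((b : ℤ) - (t : ℤ))

namespace DyckPath

variable {n : ℕ}

lemma height_emod_two (P : DyckPath n) {t : ℕ} (ht : t ≤ 2 * n) :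
    P.h t % 2 = (t : ℤ) % 2 := by
  induction t with
  | zero => simp [P.init]
  | succ k ih =>
    have := ih (by omega)
    rcases P.step k (by omega) with h | h <;> rw [h] <;> push_cast <;> omega

lemma height_succ_bounds (P : DyckPath n) (t : ℕ) :
    P.h (t + 1) ≤ P.h t + 1 ∧ P.h t ≤ P.h (t + 1) + 1 := by
  by_cases ht : t < 2 * n
  · rcases P.step t ht with h | h <;> omega
  · have := P.tail t (by omega)
    have := P.tail (t + 1) (by omega)
    omega

lemma height_add_bounds (P : DyckPath n) (a k : ℕ) :
    P.h (a + k) ≤ P.h a + k ∧ P.h a ≤ P.h (a + k) + k := by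
  induction k with
  | zero => simp
  | succ k ih =>
    have := P.height_succ_bounds (a + k)
    rw [← add_assoc]
    push_cast
    omega

/-- Between two zeroes a path lies below the pyramid with the same base. -/
lemma height_le_pyramid (P : DyckPath n) {a b t : ℕ} (ha : P.h a = 0) (hb : P.h b = 0)
    (hat : a ≤ t) (htb : t ≤ b) : P.h t ≤ min ((t : ℤ) - a) ((b : ℤ) - t) := by
  obtain ⟨k, rfl⟩ := Nat.exists_eq_add_of_le hat
  obtain ⟨l, rfl⟩ := Nat.exists_eq_add_of_le htb
  have := P.height_add_bounds a k
  have := P.height_add_bounds (a + k) l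
  push_cast at *
  omega

lemma even_of_height_eq_zero (P : DyckPath n) {t : ℕ} (ht : t ≤ 2 * n) (h : P.h t = 0) :
    t % 2 = 0 := by
  have := P.height_emod_two ht
  omega

/-- Two paths meet in the minimum path iff at every even abscissa one of them is zero. -/
lemma inf_le_minPath_iff (P S : DyckPath n) :
    (∀ t, min (P.h t) (S.h t) ≤ (minPath n).h t) ↔
      ∀ t, t % 2 = 0 → P.h t = 0 ∨ S.h t = 0 := by
  simp only [minPath, minH]
  constructor
  · intro h t ht
    have := h t
    have := P.nonneg t
    have := S.nonneg t
    split_ifs at * <;> omega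
  · intro h t
    by_cases ht : 2 * n ≤ t
    · simp [P.tail t ht, ht]
    rw [if_neg ht]
    rcases Nat.mod_two_eq_zero_or_one t with he | ho
    · have := h t he
      omega
    · obtain ⟨s, rfl⟩ : ∃ s, t = s + 1 := ⟨t - 1, by omega⟩
      have := h s (by omega)
      have := P.height_succ_bounds s
      have := S.height_succ_bounds s
      omega

/-- The path with a single pyramid on `[a, b]` and hills elsewhere. -/
def singlePyramid (n a b : ℕ) (ha : a % 2 = 0) (hb : b % 2 = 0) (hab : a < b)
    (hbn : b ≤ 2 * n) : DyckPath n where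
  h t := if a ≤ t ∧ t ≤ b then min ((t : ℤ) - a) ((b : ℤ) - t) else minH n t
  init := by simp only [minH]; split_ifs <;> omega
  tail := by intro t ht; simp only [minH]; split_ifs <;> omega
  step := by intro t ht; simp only [minH]; split_ifs <;> omega
  nonneg := by intro t; simp only [minH]; split_ifs <;> omega

end DyckPath

/-- If `P` vanishes at every even point strictly between `a` and `b`, its pseudocomplement
lies above the pyramid on `[a, b]`. -/
lemma IsPseudo.pyramid_le {n : ℕ} {P Q : DyckPath n} (h : IsPseudo P Q) {a b : ℕ}
    (ha : a % 2 = 0) (hb : b % 2 = 0) (hab : a < b) (hbn : b ≤ 2 * n)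
    (hz : ∀ c, a < c → c < b → c % 2 = 0 → P.h c = 0) {t : ℕ} (hat : a ≤ t) (htb : t ≤ b) :
    min ((t : ℤ) - a) ((b : ℤ) - t) ≤ Q.h t := by
  have := h.2 (DyckPath.singlePyramid n a b ha hb hab hbn) ?_ t
  · simpa only [DyckPath.singlePyramid, if_pos (And.intro hat htb)] using this
  · rw [DyckPath.inf_le_minPath_iff]
    intro s hs
    by_cases hc : a < s ∧ s < b
    · exact Or.inl (hz s hc.1 hc.2 hs)
    · right
      simp only [DyckPath.singlePyramid, minH]
      split_ifs <;> omega

/-- At interior even points the pseudocomplement vanishes exactly where `P` does not. -/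
lemma IsPseudo.height_eq_zero_iff {n : ℕ} {P Q : DyckPath n} (h : IsPseudo P Q) {t : ℕ}
    (ht : t % 2 = 0) (h0 : 0 < t) (htn : t < 2 * n) : Q.h t = 0 ↔ P.h t ≠ 0 := by
  constructor
  · intro hQ hP
    have := h.pyramid_le (a := t - 2) (b := t + 2) (t := t) (by omega) (by omega) (by omega)
      (by omega) (fun c _ _ _ => by rwa [show c = t by omega]) (by omega) (by omega)
    omega
  · intro hP
    exact (((DyckPath.inf_le_minPath_iff P Q).1 h.1) t ht).resolve_left hP

lemma IsPseudo.height_eq_zero_iff_of_isPseudo {n : ℕ} {P Q R : DyckPath n} (h1 : IsPseudo P Q)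
    (h2 : IsPseudo Q R) (t : ℕ) : R.h t = 0 ↔ P.h t = 0 := by
  rcases Nat.eq_zero_or_pos t with rfl | h0
  · simp [P.init, R.init]
  by_cases htn : t < 2 * n
  · rcases Nat.mod_two_eq_zero_or_one t with he | ho
    · rw [h2.height_eq_zero_iff he h0 htn, Ne, h1.height_eq_zero_iff he h0 htn, not_not]
    · have := P.height_emod_two htn.le
      have := R.height_emod_two htn.le
      omega
  · simp [P.tail t (by omega), R.tail t (by omega)]

/-- The double pseudocomplement replaces each factor of `P` by a pyramid. -/
lemma IsPseudo.height_eq_pyramid {n : ℕ} {P Q R : DyckPath n} (h1 : IsPseudo P Q)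
    (h2 : IsPseudo Q R) {a b : ℕ} (hab : a < b) (hbn : b ≤ 2 * n) (ha : P.h a = 0)
    (hb : P.h b = 0) (hpos : ∀ c, a < c → c < b → 0 < P.h c) {t : ℕ} (hat : a ≤ t)
    (htb : t ≤ b) : R.h t = min ((t : ℤ) - a) ((b : ℤ) - t) := by
  have hz := h1.height_eq_zero_iff_of_isPseudo h2
  refine le_antisymm (R.height_le_pyramid ((hz a).2 ha) ((hz b).2 hb) hat htb) ?_
  refine h2.pyramid_le (P.even_of_height_eq_zero (by omega) ha)
    (P.even_of_height_eq_zero hbn hb) hab hbn (fun c hac hcb hc => ?_) hat htb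
  exact (h1.height_eq_zero_iff hc (by omega) (by omega)).2 (hpos c hac hcb).ne'

lemma isReturn_congr {n : ℕ} {P R : DyckPath n} (hz : ∀ t, R.h t = 0 ↔ P.h t = 0) (x : ℕ) :
    IsReturn R x ↔ IsReturn P x := by
  simp only [IsReturn, hz]

lemma height_eq_zero_iff_of_isReturn_iff {n : ℕ} {P S : DyckPath n}
    (hr : ∀ x, IsReturn S x ↔ IsReturn P x) (t : ℕ) : S.h t = 0 ↔ P.h t = 0 := by
  rcases Nat.eq_zero_or_pos t with rfl | h0
  · simp [P.init, S.init]
  by_cases htn : t < 2 * n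
  · rcases Nat.mod_two_eq_zero_or_one t with he | ho
    · have := hr t
      simpa [IsReturn, Nat.even_iff, he, show 2 ≤ t by omega, htn.le] using this
    · have := P.height_emod_two htn.le
      have := S.height_emod_two htn.le
      omega
  · simp [P.tail t (by omega), S.tail t (by omega)]

/-- Every point below `2 * n` lies in a factor. -/
lemma DyckPath.exists_factor {n : ℕ} (P : DyckPath n) {t : ℕ} (ht : t < 2 * n) :
    ∃ a b, a < b ∧ b ≤ 2 * n ∧ P.h a = 0 ∧ P.h b = 0 ∧ (∀ c, a < c → c < b → 0 < P.h c) ∧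
      a ≤ t ∧ t ≤ b := by
  classical
  have hex : ∃ b, t < b ∧ P.h b = 0 := ⟨2 * n, ht, P.tail _ le_rfl⟩
  have hb := Nat.find_spec hex
  have ha := Nat.findGreatest_spec (P := fun a => P.h a = 0) (Nat.zero_le t) P.init
  have hat := Nat.findGreatest_le (P := fun a => P.h a = 0) t
  refine ⟨Nat.findGreatest (fun a => P.h a = 0) t, Nat.find hex, by omega,
    Nat.find_min' hex ⟨ht, P.tail _ le_rfl⟩, ha, hb.2, fun c hac hcb => ?_, hat, hb.1.le⟩
  refine (P.nonneg c).lt_of_ne' fun hc => ?_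
  rcases le_or_gt c t with h | h
  · exact Nat.findGreatest_is_greatest hac h hc
  · exact Nat.find_min hex hcb ⟨h, hc⟩

/-- A path all of whose factors are pyramids is determined by its zeroes. -/
lemma FactorsArePyramids.eq_of_height_eq_zero_iff {n : ℕ} {S R : DyckPath n}
    (hS : FactorsArePyramids S) (hR : FactorsArePyramids R)
    (hz : ∀ t, S.h t = 0 ↔ R.h t = 0) : S = R := by
  have hh : S.h = R.h := by
    funext t
    by_cases ht : t < 2 * n
    · obtain ⟨a, b, hab, hbn, ha, hb, hpos, hat, htb⟩ := R.exists_factor ht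
      rw [hR a b hab hbn ha hb hpos t hat htb]
      refine hS a b hab hbn ((hz a).2 ha) ((hz b).2 hb) (fun c hac hcb => ?_) t hat htb
      exact (S.nonneg c).lt_of_ne' (mt (hz c).1 (hpos c hac hcb).ne')
    · rw [S.tail t (by omega), R.tail t (by omega)]
  cases S
  cases R
  simpa using hh

/-- The double pseudocomplement `∼∼P` is the unique Dyck path of semilength `n`
all of whose factors are pyramids and having exactly the same returns as `P`;
equivalently, it is obtained from `P` by replacing each factor of `P` (the portion
between two consecutive zeroes `a < b` of the height of `P`) by the unique pyramid
with the same number of steps. -/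
theorem double_pseudo_characterization (n : ℕ) (P Q R : DyckPath n)
    (h1 : IsPseudo P Q) (h2 : IsPseudo Q R) :
    (FactorsArePyramids R ∧ (∀ x : ℕ, IsReturn R x ↔ IsReturn P x) ∧
      ∀ S : DyckPath n, FactorsArePyramids S → (∀ x : ℕ, IsReturn S x ↔ IsReturn P x) →
        S = R) ∧
    (∀ a b : ℕ, a < b → b ≤ 2 * n → P.h a = 0 → P.h b = 0 →
      (∀ c, a < c → c < b → 0 < P.h c) →
      ∀ t, a ≤ t → t ≤ b → R.h t = min ((t : ℤ) - (a : ℤ)) ((b : ℤ) - (t : ℤ))) := by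
  have hz := h1.height_eq_zero_iff_of_isPseudo h2
  have hR : FactorsArePyramids R := fun a b hab hbn ha hb hpos t hat htb =>
    h1.height_eq_pyramid h2 hab hbn ((hz a).1 ha) ((hz b).1 hb)
      (fun c hac hcb => (P.nonneg c).lt_of_ne' (mt (hz c).2 (hpos c hac hcb).ne')) hat htb
  refine ⟨⟨hR, isReturn_congr hz, fun S hS hr => hS.eq_of_height_eq_zero_iff hR fun t => ?_⟩,
    fun a b hab hbn ha hb hpos t hat htb => h1.height_eq_pyramid h2 hab hbn ha hb hpos hat htb⟩
  rw [height_eq_zero_iff_of_isReturn_iff hr, hz]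
end

section
/- Let n ≥ 2. Let [Θ_{n−1}] be the quotient of Θ_{n−1} by semantic equivalence (φ ⊨⊣ ψ iff φ(I) = ψ(I) for every interval I of T_{n−1}), partially ordered by [φ] ≤ [ψ] iff φ(I) ≤ ψ(I) for every interval I. Then there exists an order isomorphism f : [Θ_{n−1}] → D_n onto the Dyck lattice of order n which moreover satisfies f([φ ⇝ ψ]) = f([φ]) ⇝ f([ψ]) for all φ, ψ ∈ Θ_{n−1}; that is, the Dyck algebra 𝔇_n of Dyck paths of semilength n is isomorphic, as a Heyting algebra, to [Θ_{n−1}]. -/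
/-- Formulas of the interval temporal logic `ITL_n`, with propositional variables
`ε_1, …, ε_n` (indexed by `Fin n`), the classical connectives `∨, ∧, →, ¬`,
the pseudonegation `∼` (`snot`) and the pseudoimplication `⇝` (`simp`). -/
inductive ITL (n : ℕ) : Type where
  | bot : ITL n
  | top : ITL n
  | var : Fin n → ITL n
  | or : ITL n → ITL n → ITL n
  | and : ITL n → ITL n → ITL n
  | imp : ITL n → ITL n → ITL n
  | not : ITL n → ITL n
  | snot : ITL n → ITL n
  | simp : ITL n → ITL n → ITL n

/-- An interval `[t_i, t_j]` (with `i ≤ j`) of the chain `T_n = {t_1 < ⋯ < t_n}`,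
encoded by its endpoints in `Fin n`. -/
abbrev Ivl (n : ℕ) : Type := {p : Fin n × Fin n // p.1 ≤ p.2}

/-- `SubIvl J I` means that the interval `J` is a subinterval of `I`. -/
def SubIvl {n : ℕ} (J I : Ivl n) : Prop := I.1.1 ≤ J.1.1 ∧ J.1.2 ≤ I.1.2

/-- The truth value of a formula at an interval: `eval φ I` means `φ(I) = 1`. -/
def eval {n : ℕ} : ITL n → Ivl n → Prop
  | .bot, _ => False
  | .top, _ => True
  | .var i, I => I.1.1 = i ∧ I.1.2 = i
  | .or φ ψ, I => eval φ I ∨ eval ψ I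
  | .and φ ψ, I => eval φ I ∧ eval ψ I
  | .imp φ ψ, I => eval φ I → eval ψ I
  | .not φ, I => ¬ eval φ I
  | .snot φ, I => ∀ J : Ivl n, SubIvl J I → ¬ eval φ J
  | .simp φ ψ, I => ∀ J : Ivl n, SubIvl J I → eval φ J → eval ψ J

/-- `Θ_n`: the set of formulas `φ` such that `φ → □φ` is valid, i.e. whenever
`φ(I) = 1` and `J ⊆ I`, also `φ(J) = 1`. -/
def Theta {n : ℕ} (φ : ITL n) : Prop :=
  ∀ I J : Ivl n, SubIvl J I → eval φ I → eval φ J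

/-- The elements of `Θ_m`, as a subtype of `ITL m`. -/
abbrev ThetaSub (m : ℕ) : Type := {φ : ITL m // Theta φ}

/-- Semantic equivalence on `Θ_m`: `φ ⊨⊣ ψ` iff `φ(I) = ψ(I)` for every interval `I`. -/
instance thetaSetoid (m : ℕ) : Setoid (ThetaSub m) :=
  ⟨fun φ ψ => ∀ I : Ivl m, eval φ.1 I ↔ eval ψ.1 I,
    ⟨fun _ _ => Iff.rfl, fun h I => (h I).symm, fun h1 h2 I => (h1 I).trans (h2 I)⟩⟩

/-- The quotient `[Θ_m]` of `Θ_m` by semantic equivalence. -/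
abbrev ThetaQuot (m : ℕ) : Type := Quotient (thetaSetoid m)

/-- The partial order on `[Θ_m]`: `[φ] ≤ [ψ]` iff `φ(I) ≤ ψ(I)` for every interval `I`. -/
def qle {m : ℕ} (a b : ThetaQuot m) : Prop :=
  Quotient.lift₂ (fun φ ψ : ThetaSub m => ∀ I : Ivl m, eval φ.1 I → eval ψ.1 I)
    (by
      intro a₁ b₁ a₂ b₂ ha hb
      have ha' : ∀ I : Ivl m, eval a₁.1 I ↔ eval a₂.1 I := ha
      have hb' : ∀ I : Ivl m, eval b₁.1 I ↔ eval b₂.1 I := hb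
      apply propext
      constructor
      · intro hI I h2
        exact (hb' I).mp (hI I ((ha' I).mpr h2))
      · intro hI I h2
        exact (hb' I).mpr (hI I ((ha' I).mp h2))) a b

namespace DyckPath

variable {n : ℕ}

theorem ext_h {P Q : DyckPath n} (H : ∀ t, P.h t = Q.h t) : P = Q := by
  cases P
  cases Q
  congr
  exact funext H

theorem even_h_add (P : DyckPath n) : ∀ t, t ≤ 2 * n → (P.h t + t) % 2 = 0 := by
  intro t
  induction t with
  | zero => intro _; simp [P.init]
  | succ t ih =>
    intro ht
    have := ih (by omega)
    have := P.step t (by omega)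
    push_cast
    omega

theorem h_le_self (P : DyckPath n) : ∀ t, t ≤ 2 * n → P.h t ≤ t := by
  intro t
  induction t with
  | zero => intro _; simp [P.init]
  | succ t ih =>
    intro ht
    have := ih (by omega)
    have := P.step t (by omega)
    push_cast
    omega

theorem h_le_sub (P : DyckPath n) : ∀ s t, t + s = 2 * n → P.h t ≤ s := by
  intro s
  induction s with
  | zero => intro t ht; simp [P.tail t (by omega)]
  | succ s ih =>
    intro t ht
    have := ih (t + 1) (by omega)
    have := P.step t (by omega)
    push_cast
    omega

/-- The interval `I = [t_i, t_j]` lies below `P` when `P` reaches the apex of the pyramid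
attached to `I`, at abscissa `i + j + 2` and height `j - i + 2` (indices starting at `0`). -/
def Covers {m : ℕ} (P : DyckPath n) (I : Ivl m) : Prop :=
  (I.1.2 : ℤ) - (I.1.1 : ℤ) + 2 ≤ P.h ((I.1.1 : ℕ) + (I.1.2 : ℕ) + 2)

theorem min_le_iff_covers (P R Q : DyckPath n) :
    (∀ t, min (P.h t) (R.h t) ≤ Q.h t) ↔
      ∀ I : Ivl (n - 1), P.Covers I → R.Covers I → Q.Covers I := by
  constructor
  · intro H I hP hR
    exact (le_min hP hR).trans (H _)
  · intro H t
    by_contra hlt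
    rcases le_or_gt (2 * n) t with ht | ht
    · simp [P.tail t ht, R.tail t ht, Q.tail t ht] at hlt
    obtain ⟨k, hk⟩ : ∃ k : ℕ, (k : ℤ) = min (P.h t) (R.h t) :=
      ⟨_, Int.toNat_of_nonneg (le_min (P.nonneg t) (R.nonneg t))⟩
    have hP := P.even_h_add t ht.le
    have hR := R.even_h_add t ht.le
    have hQ := Q.even_h_add t ht.le
    have hQ0 := Q.nonneg t
    have hPt := P.h_le_self t ht.le
    have hRt := R.h_le_self t ht.le
    have hPs := P.h_le_sub (2 * n - t) t (by omega)
    have hRs := R.h_le_sub (2 * n - t) t (by omega)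
    obtain ⟨i, hi⟩ : ∃ i, t = k + 2 * i := ⟨(t - k) / 2, by omega⟩
    have hk2 : 2 ≤ k := by omega
    have hsum : i + (i + k - 2) + 2 = t := by omega
    have := H ⟨(⟨i, by omega⟩, ⟨i + k - 2, by omega⟩), by simp only [Fin.mk_le_mk]; omega⟩
    simp only [Covers, hsum] at this
    omega

theorem dle_iff_covers (P Q : DyckPath n) :
    dle P Q ↔ ∀ I : Ivl (n - 1), P.Covers I → Q.Covers I := by
  have := min_le_iff_covers P P Q
  simp only [min_self] at this
  exact this.trans ⟨fun H I h => H I h h, fun H I h _ => H I h⟩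

theorem exists_height_of_ivl (S : Ivl (n - 1) → Prop) (t : ℕ) :
    ∃ v : ℤ, minH n t ≤ v ∧
      (∀ I, S I → (I.1.1 : ℕ) + (I.1.2 : ℕ) + 2 = t → (I.1.2 : ℤ) - (I.1.1 : ℤ) + 2 ≤ v) ∧
      (v = minH n t ∨
        ∃ I, S I ∧ (I.1.1 : ℕ) + (I.1.2 : ℕ) + 2 = t ∧ v = (I.1.2 : ℤ) - (I.1.1 : ℤ) + 2) := by
  classical
  have hmin : minH n t ≤ 1 := by unfold minH; split_ifs <;> omega
  rcases (Finset.univ.filter fun I : Ivl (n - 1) =>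
      S I ∧ (I.1.1 : ℕ) + (I.1.2 : ℕ) + 2 = t).eq_empty_or_nonempty with he | hne
  · refine ⟨minH n t, le_rfl, fun I hI ht => ?_, Or.inl rfl⟩
    exact absurd ⟨hI, ht⟩ (Finset.filter_eq_empty_iff.1 he (Finset.mem_univ I))
  · obtain ⟨I, hI, hmax⟩ := Finset.exists_max_image _
      (fun I : Ivl (n - 1) => (I.1.2 : ℤ) - (I.1.1 : ℤ) + 2) hne
    rw [Finset.mem_filter] at hI
    refine ⟨_, ?_, fun J hJ ht => hmax J (by simp [hJ, ht]), Or.inr ⟨I, hI.2.1, hI.2.2, rfl⟩⟩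
    have : (I.1.1 : ℕ) ≤ (I.1.2 : ℕ) := I.2
    omega

theorem exists_covers_iff (S : Ivl (n - 1) → Prop)
    (hS : ∀ I J, SubIvl J I → S I → S J) :
    ∃ P : DyckPath n, ∀ I, P.Covers I ↔ S I := by
  choose h hmin hle hex using exists_height_of_ivl S
  have hm0 : ∀ t, 0 ≤ minH n t ∧ minH n t ≤ 1 := by
    intro t; unfold minH; split_ifs <;> omega
  have bounds : ∀ I : Ivl (n - 1), (I.1.1 : ℕ) ≤ (I.1.2 : ℕ) ∧ (I.1.2 : ℕ) < n - 1 :=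
    fun I => ⟨I.2, I.1.2.2⟩
  have parity : ∀ t, t < 2 * n → (h t - t) % 2 = 0 := by
    intro t ht
    rcases hex t with hv | ⟨I, -, hI, hv⟩
    · rw [hv]; unfold minH; split_ifs <;> omega
    · omega
  have tail : ∀ t, 2 * n ≤ t → h t = 0 := by
    intro t ht
    rcases hex t with hv | ⟨I, -, hI, hv⟩
    · rw [hv]; unfold minH; split_ifs <;> omega
    · have := bounds I; omega
  have right : ∀ t, h t ≤ h (t + 1) + 1 := by
    intro t
    have h0 := hm0 (t + 1)
    have h0' := hm0 t
    have h1 := hmin (t + 1)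
    rcases hex t with hv | ⟨I, hI, ht, hv⟩
    · omega
    · obtain ⟨b1, b2⟩ := bounds I
      rcases b1.eq_or_lt with hij | hij
      · have : minH n (t + 1) = 1 := by unfold minH; split_ifs <;> omega
        omega
      · have := hle (t + 1) ⟨(⟨I.1.1 + 1, by omega⟩, I.1.2), Nat.succ_le_of_lt hij⟩
          (hS I _ ⟨Nat.le_succ _, le_rfl⟩ hI) (by simp only; omega)
        simp only at this
        push_cast at this
        omega
  have left : ∀ t, h (t + 1) ≤ h t + 1 := by
    intro t
    have h0 := hm0 (t + 1)
    have h0' := hm0 t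
    have h1 := hmin t
    rcases hex (t + 1) with hv | ⟨I, hI, ht, hv⟩
    · omega
    · obtain ⟨b1, b2⟩ := bounds I
      rcases b1.eq_or_lt with hij | hij
      · have : minH n t = 1 := by unfold minH; split_ifs <;> omega
        omega
      · have := hle t ⟨(I.1.1, ⟨I.1.2 - 1, by omega⟩), Nat.le_sub_one_of_lt hij⟩
          (hS I _ ⟨le_rfl, Nat.sub_le _ _⟩ hI) (by simp only; omega)
        simp only at this
        omega
  refine ⟨⟨h, ?_, tail, ?_, fun t => (hm0 t).1.trans (hmin t)⟩, fun I => ⟨fun hI => ?_, fun hI => ?_⟩⟩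
  · rcases hex 0 with hv | ⟨I, -, hI, -⟩
    · simp [hv, minH]
    · omega
  · intro t ht
    have h1 := right t
    have h2 := left t
    have h3 := parity t ht
    rcases eq_or_ne (t + 1) (2 * n) with he | he
    · have := tail (t + 1) he.ge
      omega
    · have := parity (t + 1) (by omega)
      omega
  · simp only [Covers] at hI
    have hb := bounds I
    rcases hex ((I.1.1 : ℕ) + (I.1.2 : ℕ) + 2) with hv | ⟨J, hJ, ht, hv⟩
    · have := hm0 ((I.1.1 : ℕ) + (I.1.2 : ℕ) + 2)
      omega
    · refine hS J I ⟨?_, ?_⟩ hJ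
      · rw [Fin.le_def]; omega
      · rw [Fin.le_def]; omega
  · exact hle _ I hI rfl

end DyckPath

namespace ITL

variable {m : ℕ}

theorem exists_eval_iff_forall_mem {α : Type*} (l : List α) (φ : α → ITL m) :
    ∃ ψ : ITL m, ∀ I, eval ψ I ↔ ∀ a ∈ l, eval (φ a) I := by
  induction l with
  | nil => exact ⟨.top, by simp [eval]⟩
  | cons a l ih =>
    obtain ⟨ψ, hψ⟩ := ih
    exact ⟨.and (φ a) ψ, fun I => by simp [eval, hψ]⟩

theorem exists_eval_iff_exists_mem {α : Type*} (l : List α) (φ : α → ITL m) :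
    ∃ ψ : ITL m, ∀ I, eval ψ I ↔ ∃ a ∈ l, eval (φ a) I := by
  induction l with
  | nil => exact ⟨.bot, by simp [eval]⟩
  | cons a l ih =>
    obtain ⟨ψ, hψ⟩ := ih
    exact ⟨.or (φ a) ψ, fun I => by simp [eval, hψ]⟩

theorem eval_snot_var (i : Fin m) (J : Ivl m) :
    eval (.snot (.var i)) J ↔ ¬ (J.1.1 ≤ i ∧ i ≤ J.1.2) := by
  simp only [eval]
  constructor
  · rintro H ⟨h1, h2⟩
    exact H ⟨(i, i), le_rfl⟩ ⟨h1, h2⟩ ⟨rfl, rfl⟩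
  · rintro H K ⟨h1, h2⟩ ⟨rfl, h3⟩
    exact H ⟨h1, h3 ▸ h2⟩

theorem exists_eval_iff_subIvl (I : Ivl m) :
    ∃ ψ : ITL m, ∀ J, eval ψ J ↔ SubIvl J I := by
  classical
  obtain ⟨ψ, hψ⟩ := exists_eval_iff_forall_mem
    (Finset.univ.filter fun i : Fin m => ¬ (I.1.1 ≤ i ∧ i ≤ I.1.2)).toList
    (fun i => ITL.snot (ITL.var i))
  refine ⟨ψ, fun J => (hψ J).trans ?_⟩
  simp only [Finset.mem_toList, Finset.mem_filter, Finset.mem_univ, true_and, eval_snot_var,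
    not_imp_not]
  exact ⟨fun H => ⟨(H _ ⟨le_rfl, J.2⟩).1, (H _ ⟨J.2, le_rfl⟩).2⟩,
    fun H i hi => ⟨H.1.trans hi.1, hi.2.trans H.2⟩⟩

theorem exists_eval_iff (S : Ivl m → Prop) (hS : ∀ I J, SubIvl J I → S I → S J) :
    ∃ ψ : ITL m, ∀ J, eval ψ J ↔ S J := by
  classical
  choose φ hφ using exists_eval_iff_subIvl (m := m)
  obtain ⟨ψ, hψ⟩ := exists_eval_iff_exists_mem (Finset.univ.filter S).toList φ
  refine ⟨ψ, fun J => (hψ J).trans ?_⟩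
  simp only [Finset.mem_toList, Finset.mem_filter, Finset.mem_univ, true_and, hφ]
  exact ⟨fun ⟨I, hI, hJ⟩ => hS I J hJ hI, fun hJ => ⟨J, hJ, le_rfl, le_rfl⟩⟩

end ITL

theorem DyckPath.Covers.of_subIvl {n : ℕ} (P : DyckPath n) (I J : Ivl (n - 1))
    (hJI : SubIvl J I) (hI : P.Covers I) : P.Covers J := by
  have lip : ∀ s t, t + s ≤ 2 * n → P.h t ≤ P.h (t + s) + s ∧ P.h (t + s) ≤ P.h t + s := by
    intro s t
    induction s with
    | zero => simp
    | succ s ih =>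
      intro hs
      have h1 := ih (by omega)
      have h2 := P.step (t + s) (by omega)
      rw [← add_assoc]
      push_cast
      omega
  obtain ⟨h1, h2⟩ := hJI
  rw [Fin.le_def] at h1 h2
  have h3 : (J.1.1 : ℕ) ≤ (J.1.2 : ℕ) := J.2
  have h4 := I.1.2.2
  unfold Covers at *
  obtain ⟨a, ha⟩ := Nat.exists_eq_add_of_le h1
  obtain ⟨b, hb⟩ := Nat.exists_eq_add_of_le h2
  have l1 := lip a ((I.1.1 : ℕ) + (I.1.2 : ℕ) + 2) (by omega)
  have l2 := lip b ((J.1.1 : ℕ) + (J.1.2 : ℕ) + 2) (by omega)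
  have e : (I.1.1 : ℕ) + (I.1.2 : ℕ) + 2 + a = (J.1.1 : ℕ) + (J.1.2 : ℕ) + 2 + b := by omega
  rw [e] at l1
  omega

/-- The Dyck algebra `𝔇_n` of Dyck paths of semilength `n` is isomorphic, as a Heyting
algebra, to `[Θ_{n-1}]`: there is an order isomorphism `f : [Θ_{n−1}] → D_n` (a bijection
such that `[φ] ≤ [ψ]` iff `f [φ] ≤ f [ψ]`) which moreover maps `[φ ⇝ ψ]` to the relative
pseudocomplement `f [φ] ⇝ f [ψ]` in `𝔇_n`. -/
theorem dyck_algebra_iso_theta (n : ℕ) (hn : 2 ≤ n) :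
    ∃ f : ThetaQuot (n - 1) → DyckPath n,
      Function.Bijective f ∧
      (∀ a b : ThetaQuot (n - 1), qle a b ↔ dle (f a) (f b)) ∧
      (∀ (φ ψ : ThetaSub (n - 1)) (hi : Theta (ITL.simp φ.1 ψ.1)),
        IsRelPseudo (f ⟦φ⟧) (f ⟦ψ⟧)
          (f ⟦(⟨ITL.simp φ.1 ψ.1, hi⟩ : ThetaSub (n - 1))⟧)) := by
  choose F hF using fun a : ThetaQuot (n - 1) =>
    DyckPath.exists_covers_iff (eval a.out.1) a.out.2
  have hmk : ∀ (φ : ThetaSub (n - 1)) I, (F ⟦φ⟧).Covers I ↔ eval φ.1 I := fun φ I =>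
    (hF _ I).trans ((Quotient.exact (Quotient.out_eq ⟦φ⟧) : ∀ I, eval _ I ↔ eval φ.1 I) I)
  have hle : ∀ a b : ThetaQuot (n - 1), qle a b ↔ dle (F a) (F b) := by
    rintro ⟨φ⟩ ⟨ψ⟩
    rw [DyckPath.dle_iff_covers]
    exact forall_congr' fun I => imp_congr (hmk φ I).symm (hmk ψ I).symm
  refine ⟨F, ⟨?_, ?_⟩, hle, ?_⟩
  · rintro ⟨φ⟩ ⟨ψ⟩ hab
    exact Quotient.sound fun I => (hmk φ I).symm.trans
      ((iff_of_eq (congrArg (fun P => DyckPath.Covers P I) hab)).trans (hmk ψ I))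
  · intro P
    have hP := DyckPath.Covers.of_subIvl P
    obtain ⟨ψ, hψ⟩ := ITL.exists_eval_iff (fun I : Ivl (n - 1) => P.Covers I) hP
    have hθ : Theta ψ := fun I J hJI hI => (hψ J).2 (hP I J hJI ((hψ I).1 hI))
    have hcov : ∀ I, (F ⟦⟨ψ, hθ⟩⟧).Covers I ↔ P.Covers I := fun I =>
      (hmk ⟨ψ, hθ⟩ I).trans (hψ I)
    exact ⟨⟦⟨ψ, hθ⟩⟧, DyckPath.ext_h fun t => le_antisymm
      ((DyckPath.dle_iff_covers _ _).2 (fun I => (hcov I).1) t)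
      ((DyckPath.dle_iff_covers _ _).2 (fun I => (hcov I).2) t)⟩
  · intro φ ψ hi
    constructor
    · rw [DyckPath.min_le_iff_covers]
      intro I h1 h2
      rw [hmk] at h1 h2 ⊢
      exact h2 I ⟨le_rfl, le_rfl⟩ h1
    · intro S hS
      rw [DyckPath.min_le_iff_covers] at hS
      rw [DyckPath.dle_iff_covers]
      intro I hI
      rw [hmk]
      intro J hJ hφ
      exact (hmk ψ J).1 (hS J ((hmk φ J).2 hφ) (DyckPath.Covers.of_subIvl S I J hJ hI))
end

section
/- Let P ∈ D_n be a Dyck path and write F_P = {I_1, ..., I_m} with the intervals listed in increasing order of their minima. Then the number of peaks of P occurring before the first return of P (that is, peaks at indices i with i < r, where r is the least return of P) equals max{ k ∈ {1,...,m} : I_{i−1} and I_i are not distanced for all i with 2 ≤ i ≤ k } if m ≥ 1 and 1 ∈ I_1, and equals 1 otherwise. -/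
/-- The height function of the join-irreducible Dyck path `J_{[a,b]}` of semilength `n`
(`1 ≤ a ≤ b ≤ n−1`): all factors are hills except a single pyramid `u^{b−a+2} d^{b−a+2}`
occupying abscissas `2a−2` through `2b+2`. -/
def heightJ (a b t : ℕ) : ℤ :=
  if 2 * (a : ℤ) - 2 ≤ (t : ℤ) ∧ (t : ℤ) ≤ 2 * (b : ℤ) + 2 then
    min ((t : ℤ) - (2 * (a : ℤ) - 2)) (2 * (b : ℤ) + 2 - (t : ℤ))
  else (t : ℤ) % 2

/-- `J_{[a,b]} ≤ P` in the Dyck lattice: the height of the join-irreducible `J_{[a,b]}`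
is pointwise below the height of `P`. -/
def JIle {n : ℕ} (P : DyckPath n) (a b : ℕ) : Prop :=
  ∀ t, t ≤ 2 * n → heightJ a b t ≤ P.h t

/-- `[a,b]` is an interval of `[n−1] = {1, …, n−1}`. -/
def validIvl (n a b : ℕ) : Prop := 1 ≤ a ∧ a ≤ b ∧ b ≤ n - 1

/-- `F_P`: the antichain of all inclusion-maximal intervals `[a,b] ⊆ [n−1]`
with `J_{[a,b]} ≤ P` (intervals encoded as pairs `(a,b)`). -/
def FP {n : ℕ} (P : DyckPath n) : Set (ℕ × ℕ) :=
  {p | validIvl n p.1 p.2 ∧ JIle P p.1 p.2 ∧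
    ∀ q : ℕ × ℕ, validIvl n q.1 q.2 → JIle P q.1 q.2 →
      Set.Icc p.1 p.2 ⊆ Set.Icc q.1 q.2 → q = p}

/-- `‖F_P‖ = |⋃_{I ∈ F_P} I|`. -/
noncomputable def normFP {n : ℕ} (P : DyckPath n) : ℕ :=
  (⋃ p ∈ FP P, Set.Icc p.1 p.2).ncard

/-- `F_P*`: the set of internal intervals of `F_P`, those containing neither `1` nor `n−1`. -/
def FPstar {n : ℕ} (P : DyckPath n) : Set (ℕ × ℕ) :=
  {p ∈ FP P | 1 ∉ Set.Icc p.1 p.2 ∧ n - 1 ∉ Set.Icc p.1 p.2}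

/-- `P` has a peak with apex at abscissa `t`: the `t`-th letter of `P` is `u` and the
`(t+1)`-st is `d`. -/
def IsPeak {n : ℕ} (P : DyckPath n) (t : ℕ) : Prop :=
  1 ≤ t ∧ t + 1 ≤ 2 * n ∧ P.h t = P.h (t - 1) + 1 ∧ P.h (t + 1) = P.h t - 1

/-- `P` has a hill (peak at height 1, i.e. lying on the `x`-axis) with apex at abscissa `t`. -/
def IsHill {n : ℕ} (P : DyckPath n) (t : ℕ) : Prop :=
  IsPeak P t ∧ P.h (t - 1) = 0

/-- Two consecutive intervals `p = I_{i−1}` and `q = I_i` are distanced when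
`max I_{i−1} < min I_i − 1`. -/
def Distanced (p q : ℕ × ℕ) : Prop := p.2 < q.1 - 1

namespace DyckPath

variable {n : ℕ} (P : DyckPath n)

theorem step_or_eq (t : ℕ) :
    P.h (t + 1) = P.h t + 1 ∨ P.h (t + 1) = P.h t - 1 ∨
      (P.h (t + 1) = P.h t ∧ 2 * n ≤ t) := by
  by_cases ht : t < 2 * n
  · have := P.step t ht
    tauto
  · have h1 := P.tail t (by omega)
    have h2 := P.tail (t + 1) (by omega)
    omega

theorem lipschitz {s t : ℕ} (hst : s ≤ t) :
    P.h t ≤ P.h s + (t - s) ∧ P.h s ≤ P.h t + (t - s) := by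
  induction t, hst using Nat.le_induction with
  | base => simp
  | succ t _ ih =>
    have := P.step_or_eq t
    push_cast
    omega

theorem parity {t : ℕ} (ht : t ≤ 2 * n) : P.h t % 2 = (t : ℤ) % 2 := by
  induction t with
  | zero => simp [P.init]
  | succ t ih =>
    have := P.step t (by omega)
    have := ih (by omega)
    push_cast
    omega

theorem height_le {t : ℕ} (ht : t ≤ 2 * n) : P.h t ≤ t ∧ P.h t ≤ 2 * n - t := by
  have h0 := P.init
  have h1 := P.tail (2 * n) le_rfl
  have h2 := P.lipschitz (Nat.zero_le t)
  have h3 := P.lipschitz ht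
  push_cast at *
  omega

theorem jIle_iff {a b : ℕ} (hv : validIvl n a b) :
    JIle P a b ↔ (b : ℤ) - a + 2 ≤ P.h (a + b) := by
  obtain ⟨ha, hab, hb⟩ := hv
  constructor
  · intro h
    have := h (a + b) (by omega)
    unfold heightJ at this
    push_cast at this
    split_ifs at this <;> omega
  · intro h t ht
    have hp := P.parity ht
    have hn := P.nonneg t
    unfold heightJ
    split_ifs with hc
    · rcases le_total t (a + b) with hl | hl
      · have := P.lipschitz hl
        push_cast at this
        omega
      · have := P.lipschitz hl
        push_cast at this
        omega
    · omega

/-- The maximal intervals below `P` correspond to the peaks of `P` that are not hills. -/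
theorem mem_FP_iff {a b : ℕ} :
    (a, b) ∈ FP P ↔
      validIvl n a b ∧ IsPeak P (a + b) ∧ P.h (a + b) = (b : ℤ) - a + 2 := by
  constructor
  · rintro ⟨hv, hj, hmax⟩
    simp only at hv hj hmax
    have hge := (P.jIle_iff hv).1 hj
    have hv' := hv
    obtain ⟨ha, hab, hb⟩ := hv'
    have hlarger : ∀ c d : ℕ, c ≤ a → b ≤ d → c + d ≤ 2 * n →
        (d : ℤ) - c + 2 ≤ P.h (c + d) → (c, d) = (a, b) := by
      intro c d hc hd hcd h
      have := P.height_le hcd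
      push_cast at this
      have hvalid : validIvl n c d := ⟨by omega, by omega, by omega⟩
      exact hmax (c, d) hvalid ((P.jIle_iff hvalid).2 h) (Set.Icc_subset_Icc hc hd)
    have hpar := P.parity (show a + b ≤ 2 * n by omega)
    have heq : P.h (a + b) = (b : ℤ) - a + 2 := by
      by_contra hne
      have := hlarger (a - 1) (b + 1) (by omega) (by omega) (by omega) (by
        rw [show a - 1 + (b + 1) = a + b by omega]
        push_cast at hpar ⊢
        omega)
      simp at this
    refine ⟨hv, ⟨by omega, by omega, ?_, ?_⟩, heq⟩
    · rcases P.step (a + b - 1) (by omega) with h | h <;>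
        rw [show a + b - 1 + 1 = a + b by omega] at h
      · exact h
      · have := hlarger (a - 1) b (by omega) le_rfl (by omega) (by
          rw [show a - 1 + b = a + b - 1 by omega]
          omega)
        simp only [Prod.mk.injEq] at this
        omega
    · rcases P.step (a + b) (by omega) with h | h
      · have := hlarger a (b + 1) le_rfl (by omega) (by omega) (by
          rw [show a + (b + 1) = a + b + 1 by omega]
          push_cast
          omega)
        simp at this
      · exact h
  · rintro ⟨hv, ⟨h1, h2, h3, h4⟩, heq⟩
    refine ⟨hv, (P.jIle_iff hv).2 heq.ge, ?_⟩
    rintro ⟨c, d⟩ hq hj hsub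
    simp only at hq hj hsub
    have hge := (P.jIle_iff hq).1 hj
    obtain ⟨ha, hab, hb⟩ := hv
    obtain ⟨hc, hd⟩ := (Set.Icc_subset_Icc_iff hab).1 hsub
    rw [Prod.mk.injEq]
    rcases lt_trichotomy (c + d) (a + b) with hlt | he | hgt
    · have := P.lipschitz (show c + d ≤ a + b - 1 by omega)
      omega
    · rw [he] at hge
      omega
    · have := P.lipschitz (show a + b + 1 ≤ c + d by omega)
      push_cast at this
      omega

theorem exists_mem_FP_of_isPeak {t : ℕ} (ht : IsPeak P t) (h2 : 2 ≤ P.h t) :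
    ∃ a b : ℕ, (a, b) ∈ FP P ∧ a + b = t := by
  have ht' := ht
  obtain ⟨h1, htn, -, -⟩ := ht'
  have hpar := P.parity (show t ≤ 2 * n by omega)
  have hle := P.height_le (show t ≤ 2 * n by omega)
  obtain ⟨a, ha⟩ : ∃ a : ℕ, (a : ℤ) = (t - P.h t) / 2 + 1 :=
    ⟨((t - P.h t) / 2 + 1).toNat, by omega⟩
  obtain ⟨b, hb⟩ : ∃ b : ℕ, (b : ℤ) = (t + P.h t) / 2 - 1 :=
    ⟨((t + P.h t) / 2 - 1).toNat, by omega⟩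
  have hab : a + b = t := by omega
  refine ⟨a, b, P.mem_FP_iff.2 ⟨⟨by omega, by omega, by omega⟩, ?_, ?_⟩, hab⟩
  · rwa [hab]
  · rw [hab]
    omega

/-- Two peaks with no peak strictly between them are separated by a single valley. -/
theorem exists_valley {t t' : ℕ} (ht : IsPeak P t) (ht' : IsPeak P t') (hlt : t < t')
    (hno : ∀ s, t < s → s < t' → ¬ IsPeak P s) :
    ∃ v, t < v ∧ v < t' ∧ P.h v + v = P.h t + t ∧ P.h v - v = P.h t' - t' := by
  obtain ⟨-, -, -, hdown⟩ := ht
  obtain ⟨-, hn, hup, -⟩ := ht'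
  have key : ∀ s, t + 1 ≤ s → s ≤ t' → ∃ v, t < v ∧ v ≤ s ∧ P.h v + v = P.h t + t ∧
      P.h v - v = P.h s - s ∧ (v = s ∨ P.h s = P.h (s - 1) + 1) := by
    intro s hs
    induction s, hs using Nat.le_induction with
    | base =>
      intro _
      exact ⟨t + 1, by omega, le_rfl, by push_cast; omega, rfl, Or.inl rfl⟩
    | succ s hs ih =>
      intro hst
      obtain ⟨v, hv1, hv2, hv3, hv4, hv5⟩ := ih (by omega)
      rcases P.step s (by omega) with h | h
      · exact ⟨v, hv1, by omega, hv3, by push_cast; omega, Or.inr (by simpa using h)⟩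
      · rcases hv5 with rfl | hv5
        · exact ⟨v + 1, by omega, le_rfl, by push_cast; omega, rfl, Or.inl rfl⟩
        · exact absurd ⟨by omega, by omega, hv5, h⟩ (hno s (by omega) (by omega))
  obtain ⟨v, hv1, hv2, hv3, hv4, hv5⟩ := key t' (by omega) le_rfl
  refine ⟨v, hv1, lt_of_le_of_ne hv2 ?_, hv3, hv4⟩
  rintro rfl
  have := P.lipschitz (show t ≤ v - 1 by omega)
  omega

/-- If the path starts with `uu`, then its first peak gives an interval starting at `1`. -/
theorem exists_mem_FP_one (h2 : P.h 2 = 2) : ∃ b : ℕ, (1, b) ∈ FP P := by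
  classical
  have hn : 2 < 2 * n := by
    by_contra hn
    have := P.tail 2 (by omega)
    omega
  have hex : ∃ t, P.h (t + 1) ≠ P.h t + 1 :=
    ⟨2 * n, by rw [P.tail _ le_rfl, P.tail _ (by omega)]; decide⟩
  obtain ⟨t, ht, hmin⟩ : ∃ t, P.h (t + 1) ≠ P.h t + 1 ∧ ∀ s < t, P.h (s + 1) = P.h s + 1 :=
    ⟨Nat.find hex, Nat.find_spec hex, fun s hs => not_not.1 (Nat.find_min hex hs)⟩
  have hlin : ∀ s ≤ t, P.h s = s := by
    intro s
    induction s with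
    | zero => simp [P.init]
    | succ s ih =>
      intro hs
      rw [hmin s (by omega), ih (by omega)]
      push_cast
      rfl
  have h0 := P.init
  have hh1 : P.h 1 = 1 := by
    have h1 := P.step 0 (by omega)
    have h3 := P.step 1 (by omega)
    have h4 := P.nonneg 1
    norm_num at h1 h3
    omega
  have ht2 : 2 ≤ t := by
    by_contra hlt
    interval_cases t
    · norm_num [hh1, h0] at ht
    · norm_num [hh1, h2] at ht
  have htn : t < 2 * n := by
    by_contra hlt
    have := hlin t le_rfl
    have := P.tail t (by omega)
    omega
  have hpeak : IsPeak P t := by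
    refine ⟨by omega, by omega, ?_, ?_⟩
    · rw [hlin t le_rfl, hlin (t - 1) (by omega)]
      omega
    · have := P.step t htn
      tauto
  obtain ⟨a, b, hab, rfl⟩ := P.exists_mem_FP_of_isPeak hpeak (by rw [hlin t le_rfl]; omega)
  have hm := (P.mem_FP_iff.1 hab).2.2
  rw [hlin _ le_rfl] at hm
  obtain rfl : a = 1 := by omega
  exact ⟨b, hab⟩

theorem first_steps (hn : 1 ≤ n) : P.h 1 = 1 ∧ (P.h 2 = 0 ∨ P.h 2 = 2) := by
  have h0 := P.init
  have h1 := P.step 0 (by omega)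
  have h2 := P.step 1 (by omega)
  have h3 := P.nonneg 1
  norm_num at h1 h2
  omega

end DyckPath

/-- Write `F_P = {I_1, …, I_m}` listed in increasing order of the minima of the
intervals, and let `r` be the first (least) return of `P`. The number of peaks of `P`
occurring before `r` equals
`max { k ∈ {1,…,m} : I_{i−1}, I_i are not distanced for all 2 ≤ i ≤ k }`
if `m ≥ 1` and `1 ∈ I_1`, and equals `1` otherwise. -/
theorem peaks_before_first_return (n m : ℕ) (P : DyckPath n) (I : ℕ → ℕ × ℕ)
    (hmem : ∀ i, 1 ≤ i → i ≤ m → I i ∈ FP P)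
    (hcover : ∀ p ∈ FP P, ∃ i, 1 ≤ i ∧ i ≤ m ∧ I i = p)
    (hmono : ∀ i j, 1 ≤ i → i < j → j ≤ m → (I i).1 < (I j).1)
    (r : ℕ) (hr : IsReturn P r) (hleast : ∀ s, IsReturn P s → r ≤ s)
    (c : ℕ) (hc : c = {t | IsPeak P t ∧ t < r}.ncard) :
    (1 ≤ m ∧ 1 ∈ Set.Icc (I 1).1 (I 1).2 →
      (1 ≤ c ∧ c ≤ m ∧
        (∀ i, 2 ≤ i → i ≤ c → ¬ Distanced (I (i - 1)) (I i)) ∧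
        ∀ k, 1 ≤ k → k ≤ m → (∀ i, 2 ≤ i → i ≤ k → ¬ Distanced (I (i - 1)) (I i)) →
          k ≤ c)) ∧
    (¬ (1 ≤ m ∧ 1 ∈ Set.Icc (I 1).1 (I 1).2) → c = 1) := by
  have hr' := hr
  obtain ⟨-, hr2, hrn, hr0⟩ := hr'
  have hret : ∀ s, 1 ≤ s → s < r → P.h s ≠ 0 := by
    intro s hs hsr h0
    have hp := P.parity (show s ≤ 2 * n by omega)
    have := hleast s ⟨Nat.even_iff.2 (by omega), by omega, by omega, h0⟩
    omega
  obtain ⟨hh1, hh2⟩ := P.first_steps (by omega)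
  have hI : ∀ i, 1 ≤ i → i ≤ m → validIvl n (I i).1 (I i).2 ∧ IsPeak P ((I i).1 + (I i).2) ∧
      P.h ((I i).1 + (I i).2) = ((I i).2 : ℤ) - (I i).1 + 2 :=
    fun i h1 h2 => P.mem_FP_iff.1 (hmem i h1 h2)
  constructor
  · rintro ⟨hm, hone⟩
    have hlow : (I 1).1 = 1 := le_antisymm hone.1 (hI 1 le_rfl hm).1.1
    have hapex : ∀ i j, 1 ≤ i → i < j → j ≤ m → (I i).1 + (I i).2 < (I j).1 + (I j).2 := by
      intro i j hi hij hj
      have h1 := (hI i hi (by omega)).2.2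
      have h2 := (hI j (by omega) hj).2.2
      have h3 := hmono i j hi hij hj
      by_contra hle
      have := P.lipschitz (not_lt.1 hle)
      omega
    have hinitial : ∀ s, s ≤ (I 1).1 + (I 1).2 → P.h s = s := by
      intro s hs
      have h1 := (hI 1 le_rfl hm).2.2
      have h2 := P.lipschitz hs
      have h3 := P.lipschitz (Nat.zero_le s)
      have h4 := P.init
      omega
    have hfirst : (I 1).1 + (I 1).2 < r := by
      by_contra hle
      have := hinitial r (by omega)
      omega
    have hhigh : ∀ t, IsPeak P t → t < r → 2 ≤ P.h t := by
      rintro t ⟨h1, h2, h3, h4⟩ htr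
      by_contra hlt
      have hnn := P.nonneg (t - 1)
      obtain rfl : t = 1 := by
        by_contra hne
        exact hret (t - 1) (by omega) (by omega) (by omega)
      have hv := (hI 1 le_rfl hm).1.2.1
      have := hinitial 2 (by omega)
      norm_num at h4
      omega
    obtain ⟨k₀, hk1, hkm, hbelow, habove⟩ : ∃ k₀, 1 ≤ k₀ ∧ k₀ ≤ m ∧
        (∀ i, 1 ≤ i → i ≤ k₀ → (I i).1 + (I i).2 < r) ∧
        (∀ i, k₀ < i → i ≤ m → r ≤ (I i).1 + (I i).2) := by
      refine ⟨Nat.findGreatest (fun i => (I i).1 + (I i).2 < r) m,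
        Nat.le_findGreatest hm hfirst, Nat.findGreatest_le m, ?_,
        fun i h1 h2 => not_lt.1 (Nat.findGreatest_is_greatest
          (P := fun i => (I i).1 + (I i).2 < r) h1 h2)⟩
      intro i h1 h2
      have hs := Nat.findGreatest_spec (P := fun i => (I i).1 + (I i).2 < r) hm hfirst
      rcases h2.eq_or_lt with h2 | h2
      · rw [h2]
        exact hs
      · exact (hapex i _ h1 h2 (Nat.findGreatest_le m)).trans hs
    have hset : {t | IsPeak P t ∧ t < r} =
        (fun i => (I i).1 + (I i).2) '' (Finset.Icc 1 k₀ : Set ℕ) := by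
      ext t
      simp only [Set.mem_ofPred_eq, Set.mem_image, Finset.coe_Icc, Set.mem_Icc]
      constructor
      · rintro ⟨ht, htr⟩
        obtain ⟨a, b, hab, rfl⟩ := P.exists_mem_FP_of_isPeak ht (hhigh t ht htr)
        obtain ⟨i, h1, h2, h3⟩ := hcover _ hab
        refine ⟨i, ⟨h1, ?_⟩, by rw [h3]⟩
        by_contra hlt
        have := habove i (by omega) h2
        rw [h3] at this
        simp only at this
        omega
      · rintro ⟨i, ⟨h1, h2⟩, rfl⟩
        exact ⟨(hI i h1 (by omega)).2.1, hbelow i h1 h2⟩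
    have hinj : Set.InjOn (fun i => (I i).1 + (I i).2) (Finset.Icc 1 k₀ : Set ℕ) := by
      intro i hi j hj hij
      simp only [Finset.coe_Icc, Set.mem_Icc] at hi hj hij
      rcases lt_trichotomy i j with h | h | h
      · have := hapex i j hi.1 h (by omega)
        omega
      · exact h
      · have := hapex j i hj.1 h (by omega)
        omega
    obtain rfl : c = k₀ := by
      rw [hc, hset, hinj.ncard_image, Set.ncard_coe_finset, Nat.card_Icc]
      omega
    refine ⟨hk1, hkm, ?_, ?_⟩
    · intro i hi hic
      obtain ⟨-, hp, hph⟩ := hI (i - 1) (by omega) (by omega)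
      obtain ⟨-, hq, hqh⟩ := hI i (by omega) (by omega)
      have hir := hbelow i (by omega) hic
      obtain ⟨v, hv1, hv2, hv3, hv4⟩ := P.exists_valley hp hq
        (hapex (i - 1) i (by omega) (by omega) (by omega)) (by
          intro s hs1 hs2 hs
          have hmem' : s ∈ {t | IsPeak P t ∧ t < r} := ⟨hs, by omega⟩
          rw [hset] at hmem'
          obtain ⟨j, hj, rfl⟩ := hmem'
          simp only [Finset.coe_Icc, Set.mem_Icc] at hj hs1 hs2
          rcases lt_trichotomy j (i - 1) with h | h | h
          · have := hapex j (i - 1) hj.1 h (by omega)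
            omega
          · subst h
            omega
          · rcases (show i ≤ j by omega).eq_or_lt with h | h
            · subst h
              omega
            · have := hapex i j (by omega) h (by omega)
              omega)
      have hvpos := hret v (by omega) (by omega)
      have hvnn := P.nonneg v
      unfold Distanced
      push_cast at hv3 hv4
      omega
    · intro k hk hkm' hnd
      by_contra hlt
      have hnd' := hnd (c + 1) (by omega) (by omega)
      apply hnd'
      obtain ⟨-, -, hph⟩ := hI c (by omega) (by omega)
      obtain ⟨hv, -, hqh⟩ := hI (c + 1) (by omega) (by omega)
      have hl1 := P.lipschitz (hbelow c (by omega) le_rfl).le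
      have hl2 := P.lipschitz (habove (c + 1) (by omega) (by omega))
      have := hv.1
      unfold Distanced
      rw [Nat.add_sub_cancel]
      push_cast at hl1 hl2
      omega
  · intro hnot
    have h20 : P.h 2 = 0 := by
      refine hh2.resolve_right fun h2 => hnot ?_
      obtain ⟨b, hb⟩ := P.exists_mem_FP_one h2
      obtain ⟨i, h1, h2, h3⟩ := hcover _ hb
      have hi : i = 1 := by
        by_contra hne
        have h4 := hmono 1 i le_rfl (by omega) h2
        have h5 := (hI 1 le_rfl (by omega)).1.1
        rw [h3] at h4
        simp only at h4
        omega
      subst hi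
      refine ⟨h2, ?_⟩
      rw [h3]
      exact ⟨le_rfl, (P.mem_FP_iff.1 hb).1.2.1⟩
    have hrr : r = 2 := le_antisymm (hleast 2 ⟨even_two, le_rfl, by omega, h20⟩) hr2
    have hset : {t | IsPeak P t ∧ t < r} = {1} := by
      ext t
      simp only [Set.mem_ofPred_eq, Set.mem_singleton_iff]
      constructor
      · rintro ⟨⟨h1, -⟩, h2⟩
        omega
      · rintro rfl
        refine ⟨⟨le_rfl, by omega, ?_, ?_⟩, by omega⟩
        · simp [hh1, P.init]
        · norm_num [hh1, h20]
    rw [hc, hset, Set.ncard_singleton]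
end
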